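/- Let n ≥ 2 be an integer and let s, h, q : ℕ → ℤ satisfy: (i) ∑_{i=0}^{n-1} (-1)^i · s i = (-1)^(n-1) + 1; (ii) s (n-1) = 2 · h (n-1); (iii) q n = 2 · h (n-1); (iv) q 0 = h 0 + 1; and (v) q i = h i + s (i-1) for every i with 1 ≤ i ≤ n-1. Then ∑_{i=0}^{n} (-1)^i · q i = (∑_{i=0}^{n-1} (-1)^i · h i) + (-1)^n. -/

import Mathlib

/-- Combinatorial core of the Euler characteristic theorem for stellar structures:
if `s i` counts the `i`-simplexes of a stellar `(n-1)`-sphere `S`, `h i` those of `S/≃`,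
and `q i` those of `a ⋆ (S/≃)`, with the relations coming from regularity of `≃`,
then `χ(a ⋆ (S/≃)) = χ(S/≃) + (-1)^n`. -/
theorem stellar_euler_characteristic (n : ℕ) (hn : 2 ≤ n) (s h q : ℕ → ℤ)
    (hS : ∑ i ∈ Finset.range n, (-1 : ℤ) ^ i * s i = (-1 : ℤ) ^ (n - 1) + 1)
    (hs : s (n - 1) = 2 * h (n - 1))
    (hqn : q n = 2 * h (n - 1))
    (hq0 : q 0 = h 0 + 1)
    (hqi : ∀ i, 1 ≤ i → i ≤ n - 1 → q i = h i + s (i - 1)) :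
    ∑ i ∈ Finset.range (n + 1), (-1 : ℤ) ^ i * q i =
      (∑ i ∈ Finset.range n, (-1 : ℤ) ^ i * h i) + (-1 : ℤ) ^ n := by
  obtain ⟨m, rfl⟩ : ∃ m, n = m + 1 := ⟨n - 1, by omega⟩
  simp only [Nat.add_sub_cancel] at hS hs hqn hqi
  have hmid : ∑ i ∈ Finset.range m, (-1 : ℤ) ^ (i + 1) * q (i + 1) =
      ∑ i ∈ Finset.range m, (-1 : ℤ) ^ (i + 1) * h (i + 1) -
        ∑ i ∈ Finset.range m, (-1 : ℤ) ^ i * s i := by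
    rw [← Finset.sum_sub_distrib]
    refine Finset.sum_congr rfl fun i hi => ?_
    rw [hqi (i + 1) (by omega) (Finset.mem_range.mp hi), Nat.add_sub_cancel]
    ring
  rw [Finset.sum_range_succ] at hS
  rw [Finset.sum_range_succ, Finset.sum_range_succ', Finset.sum_range_succ' _ m, hmid, hqn, hq0,
    ← hs, pow_succ (-1 : ℤ) m]
  linear_combination -hS
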